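/- The following explicit descriptions hold: S_{Id} = {a ∈ ℤ^{N-1} : a_1 ≤ a_2 ≤ … ≤ a_{N-1} ≤ 0}; S_{ω_1} = {a ∈ ℤ^{N-1} : a_2 + 1 ≤ a_1 ≤ a_3 ≤ … ≤ a_{N-1} ≤ 0} (for N = 3 this reads a_2 + 1 ≤ a_1 ≤ 0); S_{ω_2} = {a ∈ ℤ^{N-1} : a_2 ≤ a_3 ≤ … ≤ a_{N-1} ≤ 0 < a_1}. -/

import Mathlib

open Matrix

noncomputable section

namespace IH

variable (p : ℕ) [Fact p.Prime]

/-- `\bar{𝔽}_p`, an algebraic closure of the residue field. -/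
abbrev kb := AlgebraicClosure (ZMod p)

variable (N : ℕ)

/-- `G = GL_N(F)` with `F = ℚ_p`. -/
abbrev GG := GL (Fin N) ℚ_[p]
/-- `GL_N(O_F)` (as an abstract group, mapping onto `K ⊆ G`). -/
abbrev MM := GL (Fin N) ℤ_[p]
/-- `GL_N(k_F)`. -/
abbrev Gk := GL (Fin N) (ZMod p)

/-- The inclusion `GL_N(O_F) → GL_N(F)`. -/
def iotaM : MM p N →* GG p N := Matrix.GeneralLinearGroup.map (PadicInt.Coe.ringHom)

/-- The reduction map `red : GL_N(O_F) → GL_N(k_F)`. -/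
def redM : MM p N →* Gk p N := Matrix.GeneralLinearGroup.map (PadicInt.toZMod)

/-- Elements of `GL_N(O_F)` whose reduction is upper triangular: the Iwahori condition. -/
def Ipre : Set (MM p N) :=
  {m | ∀ i j : Fin N, j < i → ((redM p N m : Matrix (Fin N) (Fin N) (ZMod p)) i j = 0)}

/-- Elements of `GL_N(O_F)` whose reduction is upper triangular unipotent: pro-p Iwahori. -/
def I1pre : Set (MM p N) :=
  {m | m ∈ Ipre p N ∧ ∀ i : Fin N, ((redM p N m : Matrix (Fin N) (Fin N) (ZMod p)) i i = 1)}

/-- Elements of `GL_N(O_F)` reducing to the identity: `K_1 = ker red`. -/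
def K1pre : Set (MM p N) := {m | redM p N m = 1}

/-- `K = GL_N(O_F)` as a subset of `G`. -/
def Kset : Set (GG p N) := Set.range (iotaM p N)
/-- The Iwahori subgroup `I ⊆ G`. -/
def Iset : Set (GG p N) := iotaM p N '' Ipre p N
/-- The pro-p Iwahori subgroup `I_1 ⊆ G`. -/
def I1set : Set (GG p N) := iotaM p N '' I1pre p N
/-- `K_1 ⊆ G`. -/
def K1set : Set (GG p N) := iotaM p N '' K1pre p N

/-- The uniformizer `ϖ = p` as a unit of `ℚ_p`. -/
def pU : ℚ_[p]ˣ :=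
  Units.mk0 (p : ℚ_[p]) (by
    have h := (Fact.out : p.Prime).ne_zero
    exact_mod_cast Nat.cast_ne_zero.mpr h)

/-- Scalar matrices as elements of `G`. -/
def scalarGL (u : ℚ_[p]ˣ) : GG p N :=
  Units.map (algebraMap ℚ_[p] (Matrix (Fin N) (Fin N) ℚ_[p])).toMonoidHom u

/-- The central element `ϖ^n · Id`. -/
def piSc (n : ℤ) : GG p N := scalarGL p N (pU p ^ n)

/-- Invertible diagonal matrices. -/
def diagGL (d : Fin N → ℚ_[p]ˣ) : GG p N where
  val := Matrix.diagonal fun i => (d i : ℚ_[p])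
  inv := Matrix.diagonal fun i => (((d i)⁻¹ : ℚ_[p]ˣ) : ℚ_[p])
  val_inv := by
    rw [Matrix.diagonal_mul_diagonal]
    simp
  inv_val := by
    rw [Matrix.diagonal_mul_diagonal]
    simp

/-- extend `a ∈ ℤ^{N-1}` by `0` in the last coordinate. -/
def expo (a : Fin (N - 1) → ℤ) : Fin N → ℤ :=
  fun i => if h : (i : ℕ) < N - 1 then a ⟨i, h⟩ else 0

/-- `t_a = diag(ϖ^{a_1}, …, ϖ^{a_{N-1}}, 1)`. -/
def tGL (a : Fin (N - 1) → ℤ) : GG p N :=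
  diagGL p N fun i => pU p ^ (expo N a i)

/-- The permutation matrix of `σ` (with `permGL σ · e_j = e_{σ j}`, so that
`permGL` is a group homomorphism). -/
def permGL (σ : Equiv.Perm (Fin N)) : GG p N where
  val := (σ⁻¹).permMatrix ℚ_[p]
  inv := σ.permMatrix ℚ_[p]
  val_inv := by
    show ((σ⁻¹).toPEquiv.toMatrix : Matrix (Fin N) (Fin N) ℚ_[p]) * σ.toPEquiv.toMatrix = 1
    rw [← PEquiv.toMatrix_trans, ← Equiv.toPEquiv_trans]
    simp only [Equiv.self_trans_symm, Equiv.symm_trans_self, Equiv.Perm.inv_def]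
    rw [Equiv.toPEquiv_refl, PEquiv.toMatrix_refl]
  inv_val := by
    show (σ.toPEquiv.toMatrix : Matrix (Fin N) (Fin N) ℚ_[p]) * (σ⁻¹).toPEquiv.toMatrix = 1
    rw [← PEquiv.toMatrix_trans, ← Equiv.toPEquiv_trans]
    simp only [Equiv.self_trans_symm, Equiv.symm_trans_self, Equiv.Perm.inv_def]
    rw [Equiv.toPEquiv_refl, PEquiv.toMatrix_refl]

/-- `ω t_a`. -/
def wS (σ : Equiv.Perm (Fin N)) (a : Fin (N - 1) → ℤ) : GG p N :=
  permGL p N σ * tGL p N a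

/-- The permutation `ω₂` (as a matrix: first row block `(0, I_{N-1})`, last row `(1,0,…,0)`). -/
def w2 : Equiv.Perm (Fin N) := (finRotate N)⁻¹

/-- `γ = ω₂ · diag(ϖ, I_{N-1})`. -/
def gammaGL : GG p N :=
  permGL p N (w2 N) * tGL p N fun i => if (i : ℕ) = 0 then 1 else 0

/-- `S_ω = {a ∈ ℤ^{N-1} : (ω t_a) I (ω t_a)⁻¹ ∩ K ⊆ I}`. -/
def Sset (σ : Equiv.Perm (Fin N)) : Set (Fin (N - 1) → ℤ) :=
  {a | ∀ g ∈ Iset p N,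
    wS p N σ a * g * (wS p N σ a)⁻¹ ∈ Kset p N →
    wS p N σ a * g * (wS p N σ a)⁻¹ ∈ Iset p N}

/-- The unit of `k_F^×` attached to a nonzero element of `k_F` (junk value `1` at `0`). -/
def unitOf (x : ZMod p) : (ZMod p)ˣ :=
  if h : x = 0 then 1 else Units.mk0 x h

/-- The diagonal of the reduction of `m`, as an `N`-tuple of units of `k_F`. -/
def diagOf (m : MM p N) : Fin N → (ZMod p)ˣ :=
  fun i => unitOf p ((redM p N m : Matrix (Fin N) (Fin N) (ZMod p)) i i)

/-- The transformation rule for functions in `H_{IZ}(χ)`, where the character `χ` of `I`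
is given by the character `ξ` of the torus `(k_F^×)^N` through the diagonal of the
reduction, extended to `IZ` by `χ(ϖ) = 1`. -/
def HTransf (ξ : (Fin N → (ZMod p)ˣ) →* (kb p)ˣ) (φ : GG p N → kb p) : Prop :=
  ∀ (n₁ n₂ : ℤ) (m₁ m₂ : MM p N), m₁ ∈ Ipre p N → m₂ ∈ Ipre p N → ∀ g : GG p N,
    φ (piSc p N n₁ * iotaM p N m₁ * g * (piSc p N n₂ * iotaM p N m₂)) =
      (ξ (diagOf p N m₁) : kb p) * (ξ (diagOf p N m₂) : kb p) * φ g

/-- `φ` is supported on the double coset `IZ x I`. -/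
def SuppDouble (φ : GG p N → kb p) (x : GG p N) : Prop :=
  ∀ g : GG p N, φ g ≠ 0 → ∃ (n : ℤ) (m₁ m₂ : MM p N), m₁ ∈ Ipre p N ∧ m₂ ∈ Ipre p N ∧
    g = piSc p N n * iotaM p N m₁ * x * iotaM p N m₂

/-- Membership in `H_{IZ}(χ)`: the transformation rule together with support in
finitely many double cosets `IZ g I`. -/
def HMem (ξ : (Fin N → (ZMod p)ˣ) →* (kb p)ˣ) (φ : GG p N → kb p) : Prop :=
  HTransf p N ξ φ ∧
  ∃ S : Finset (GG p N), ∀ g : GG p N, φ g ≠ 0 →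
    ∃ s ∈ S, ∃ (n : ℤ) (m₁ m₂ : MM p N), m₁ ∈ Ipre p N ∧ m₂ ∈ Ipre p N ∧
      g = piSc p N n * iotaM p N m₁ * s * iotaM p N m₂

section Rep

variable {V : Type} [AddCommGroup V] [Module (kb p) V]

/-- `σ` (here `ρ`) is irreducible. -/
def IsIrred (ρ : Representation (kb p) (Gk p N) V) : Prop :=
  (∃ v : V, v ≠ 0) ∧
  ∀ W : Submodule (kb p) V, (∀ g v, v ∈ W → ρ g v ∈ W) → W = ⊥ ∨ W = ⊤

/-- Membership in the compact induction `ind_{KZ}^G σ`: left `KZ`-equivariance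
(where `ϖ` acts trivially), support in finitely many cosets `KZ g`, and smoothness. -/
def IndMem (ρ : Representation (kb p) (Gk p N) V) (f : GG p N → V) : Prop :=
  (∀ (n : ℤ) (m : MM p N) (g : GG p N),
      f (piSc p N n * iotaM p N m * g) = ρ (redM p N m) (f g)) ∧
  (∃ S : Finset (GG p N), ∀ g : GG p N, f g ≠ 0 →
      ∃ s ∈ S, ∃ (n : ℤ) (m : MM p N), g = piSc p N n * iotaM p N m * s) ∧
  (∃ U : Subgroup (GG p N), IsOpen (U : Set (GG p N)) ∧ ∀ u ∈ U, ∀ g, f (g * u) = f g)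

/-- `f` is invariant under right translation by `I_1`. -/
def IsI1Inv (f : GG p N → V) : Prop :=
  ∀ u ∈ I1set p N, ∀ g, f (g * u) = f g

/-- The defining property of the standard function `f_{ω,a}`: an `I_1`-invariant member of
`ind_{KZ}^G σ` supported on `KZ t_a I_1` with value `v₀` at `ω t_a`. -/
def IsStd (ρ : Representation (kb p) (Gk p N) V) (v₀ : V)
    (σp : Equiv.Perm (Fin N)) (a : Fin (N - 1) → ℤ) (f : GG p N → V) : Prop :=
  IndMem p N ρ f ∧ IsI1Inv p N f ∧
  (∀ g : GG p N, f g ≠ 0 → ∃ (n : ℤ) (m : MM p N) (u : GG p N), u ∈ I1set p N ∧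
      g = piSc p N n * iotaM p N m * tGL p N a * u) ∧
  f (wS p N σp a) = v₀

/-- `R` is a set of representatives for `I_1/(I_1 ∩ g⁻¹ I_1 g)`. -/
def IsRepSet (g : GG p N) (R : Finset (GG p N)) : Prop :=
  (↑R ⊆ I1set p N) ∧
  ∀ x ∈ I1set p N, ∃! r : GG p N, r ∈ R ∧
    (r⁻¹ * x ∈ I1set p N ∧ g * (r⁻¹ * x) * g⁻¹ ∈ I1set p N)

/-- The Hecke operator: `f|T_g = ∑_{r} (r g⁻¹)·f`, where `(h·f)(x) = f(xh)`. -/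
def hk (g : GG p N) (R : Finset (GG p N)) (f : GG p N → V) : GG p N → V :=
  fun x => ∑ r ∈ R, f (x * r * g⁻¹)

end Rep


lemma wS_conj_apply (σ : Equiv.Perm (Fin N)) (a : Fin (N - 1) → ℤ) (g : GG p N) (i j : Fin N) :
    (wS p N σ a * g * (wS p N σ a)⁻¹ : GG p N) (σ i) (σ j) =
      (p : ℚ_[p]) ^ (expo N a i - expo N a j) * g i j := by
  have hp : (p : ℚ_[p]) ≠ 0 := Nat.cast_ne_zero.mpr (Fact.out : p.Prime).ne_zero
  have h : ((wS p N σ a * g * (wS p N σ a)⁻¹ : GG p N) : Matrix (Fin N) (Fin N) ℚ_[p]) =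
      (σ⁻¹).toPEquiv.toMatrix * (Matrix.diagonal (fun i => (p : ℚ_[p]) ^ expo N a i) *
        (g : Matrix (Fin N) (Fin N) ℚ_[p]) *
        Matrix.diagonal fun i => ((p : ℚ_[p]) ^ expo N a i)⁻¹) * σ.toPEquiv.toMatrix := by
    rw [wS, _root_.mul_inv_rev]
    simp only [Units.val_mul, Matrix.mul_assoc]
    change (σ⁻¹).toPEquiv.toMatrix * ((Matrix.diagonal fun i => ((pU p ^ expo N a i : ℚ_[p]ˣ) :
      ℚ_[p])) * (_ * ((Matrix.diagonal fun i => (((pU p ^ expo N a i)⁻¹ : ℚ_[p]ˣ) : ℚ_[p])) *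
        σ.toPEquiv.toMatrix))) = _
    simp [pU]
  rw [h, PEquiv.toMatrix_toPEquiv_mul, PEquiv.mul_toMatrix_toPEquiv, Matrix.submatrix_apply,
    Matrix.submatrix_apply, Matrix.mul_diagonal, Matrix.diagonal_mul, zpow_sub₀ hp]
  simp only [Equiv.Perm.inv_def, Equiv.symm_apply_apply, id]
  ring

lemma iotaM_apply (m : MM p N) (i j : Fin N) : iotaM p N m i j = ((m i j : ℤ_[p]) : ℚ_[p]) := rfl

lemma iotaM_injective : Function.Injective (iotaM p N) := fun m m' h => by
  refine Units.ext (Matrix.ext fun i j => Subtype.ext ?_)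
  change iotaM p N m i j = iotaM p N m' i j
  rw [h]

lemma mem_Ipre_iff (m : MM p N) :
    m ∈ Ipre p N ↔ ∀ i j : Fin N, j < i → ‖(m i j : ℤ_[p])‖ < 1 := by
  refine forall_congr' fun i => forall_congr' fun j => imp_congr_right fun _ => ?_
  change PadicInt.toZMod (m i j) = 0 ↔ _
  rw [← RingHom.mem_ker, PadicInt.ker_toZMod, IsLocalRing.mem_maximalIdeal, PadicInt.mem_nonunits]

/-- The transvection `1 + c E_{ij}` as an element of `GL_N(O_F)`. -/
def transvectionGL {i j : Fin N} (h : i ≠ j) (c : ℤ_[p]) : MM p N :=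
  Matrix.GeneralLinearGroup.mk'' (Matrix.transvection i j c)
    (by rw [Matrix.det_transvection_of_ne i j h]; exact isUnit_one)

lemma transvectionGL_apply {i j : Fin N} (h : i ≠ j) (c : ℤ_[p]) (k l : Fin N) :
    transvectionGL p N h c k l =
      (if k = l then 1 else 0) + (if i = k ∧ j = l then c else 0) := by
  change Matrix.transvection i j c k l = _
  rw [Matrix.transvection, Matrix.add_apply, Matrix.one_apply, Matrix.single_apply]

lemma mem_Sset_iff (σ : Equiv.Perm (Fin N)) (a : Fin (N - 1) → ℤ) :
    a ∈ Sset p N σ ↔ ∀ i j : Fin N, σ j < σ i →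
      (j < i → expo N a j ≤ expo N a i) ∧ (i < j → expo N a j < expo N a i) := by
  have hp : (p : ℚ_[p]) ≠ 0 := Nat.cast_ne_zero.mpr (Fact.out : p.Prime).ne_zero
  have hp1 : (1 : ℝ) < p := by exact_mod_cast (Fact.out : p.Prime).one_lt
  constructor
  · intro ha i j hσ
    by_contra hcon
    have hij : i ≠ j := by rintro rfl; exact lt_irrefl _ hσ
    have hle : expo N a i ≤ expo N a j := by
      by_contra! hlt
      exact hcon ⟨fun _ => hlt.le, fun _ => hlt⟩
    obtain ⟨k, hk⟩ := Int.eq_ofNat_of_zero_le (sub_nonneg.mpr hle)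
    have hk0 : j < i → k ≠ 0 := by
      rintro hji rfl
      exact hcon ⟨fun _ => by simp at hk; omega, fun h => absurd h hji.asymm⟩
    set m := transvectionGL p N hij ((p : ℤ_[p]) ^ k) with hm
    have hmI : m ∈ Ipre p N := by
      rw [mem_Ipre_iff]
      intro r s hsr
      rw [hm, transvectionGL_apply, if_neg hsr.ne', zero_add]
      split_ifs with h
      · obtain ⟨rfl, rfl⟩ := h
        rw [norm_pow, PadicInt.norm_p]
        exact pow_lt_one₀ (by positivity) (inv_lt_one_of_one_lt₀ hp1) (hk0 hsr)
      · simp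
    set m' := transvectionGL p N (σ.injective.ne hij) 1 with hm'
    have hconj : iotaM p N m' = wS p N σ a * iotaM p N m * (wS p N σ a)⁻¹ := by
      ext r s
      obtain ⟨r, rfl⟩ := σ.surjective r
      obtain ⟨s, rfl⟩ := σ.surjective s
      rw [wS_conj_apply, iotaM_apply, iotaM_apply, hm, hm', transvectionGL_apply,
        transvectionGL_apply]
      simp only [σ.injective.eq_iff]
      by_cases h : i = r ∧ j = s
      · obtain ⟨rfl, rfl⟩ := h
        have : expo N a i - expo N a j = -(k : ℤ) := by
          change expo N a j - expo N a i = (k : ℤ) at hk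
          omega
        simp [hij, this, hp]
      · by_cases hrs : r = s
        · subst hrs
          simp [h]
        · simp [h, hrs]
    obtain ⟨m'', hm''I, hm''⟩ := ha _ ⟨m, hmI, rfl⟩ ⟨m', hconj⟩
    rw [← hconj] at hm''
    rw [iotaM_injective p N hm'', mem_Ipre_iff] at hm''I
    have := hm''I _ _ hσ
    rw [hm', transvectionGL_apply, if_neg (σ.injective.ne hij)] at this
    simp at this
  · rintro h _ ⟨m, hmI, rfl⟩ ⟨m', hm'⟩
    refine ⟨m', (mem_Ipre_iff p N m').mpr fun r s hsr => ?_, hm'⟩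
    rw [mem_Ipre_iff] at hmI
    obtain ⟨i, rfl⟩ := σ.surjective r
    obtain ⟨j, rfl⟩ := σ.surjective s
    change ‖iotaM p N m' (σ i) (σ j)‖ < 1
    rw [hm', wS_conj_apply, norm_mul, Padic.norm_p_zpow, iotaM_apply, ← PadicInt.norm_def]
    have hle := PadicInt.norm_le_one (m i j)
    rcases lt_trichotomy i j with hij | rfl | hji
    · have := (h i j hsr).2 hij
      exact mul_lt_one_of_nonneg_of_lt_one_left (by positivity)
        (zpow_lt_one_of_neg₀ hp1 (by omega)) hle
    · exact absurd hsr (lt_irrefl _)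
    · have := (h i j hsr).1 hji
      exact mul_lt_one_of_nonneg_of_lt_one_right
        (zpow_le_one_of_nonpos₀ hp1.le (by omega)) (norm_nonneg _) (hmI i j hji)

lemma expo_castSucc (n : ℕ) (a : Fin (n + 2) → ℤ) (i : Fin (n + 2)) :
    expo (n + 3) a i.castSucc = a i :=
  dif_pos i.isLt

lemma expo_last (n : ℕ) (a : Fin (n + 2) → ℤ) : expo (n + 3) a (Fin.last (n + 2)) = 0 :=
  dif_neg (lt_irrefl _)

lemma w2_zero (n : ℕ) : w2 (n + 3) 0 = Fin.last (n + 2) := by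
  rw [w2, Equiv.Perm.inv_eq_iff_eq]
  simp

lemma w2_succ (n : ℕ) (i : Fin (n + 2)) : w2 (n + 3) i.succ = i.castSucc := by
  rw [w2, Equiv.Perm.inv_eq_iff_eq]
  simp

lemma swap_zero_one_lt_iff (n : ℕ) (i j : Fin (n + 3)) :
    Equiv.swap (0 : Fin (n + 3)) 1 j < Equiv.swap (0 : Fin (n + 3)) 1 i ↔
      j = 1 ∧ i = 0 ∨ j < i ∧ ¬(j = 0 ∧ i = 1) := by
  simp only [Equiv.swap_apply_def]
  split_ifs <;> simp only [Fin.lt_def, Fin.ext_iff, Fin.val_zero, Fin.val_one] at * <;> omega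

/-- explicit description of `S_{Id}`, `S_{ω₁}` and `S_{ω₂}`. -/
theorem stmt4 (p : ℕ) [Fact p.Prime] (n : ℕ) :
    Sset p (n + 3) 1 =
      {a : Fin (n + 2) → ℤ | (∀ i j : Fin (n + 2), i ≤ j → a i ≤ a j) ∧ ∀ i, a i ≤ 0} ∧
    Sset p (n + 3) (Equiv.swap (0 : Fin (n + 3)) 1) =
      {a : Fin (n + 2) → ℤ | a 1 + 1 ≤ a 0 ∧
        (∀ i j : Fin (n + 2), i ≤ j → i ≠ 1 → j ≠ 1 → a i ≤ a j) ∧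
        ∀ i, i ≠ (1 : Fin (n + 2)) → a i ≤ 0} ∧
    Sset p (n + 3) (w2 (n + 3)) =
      {a : Fin (n + 2) → ℤ | (∀ i j : Fin (n + 2), i ≤ j → i ≠ 0 → a i ≤ a j) ∧
        (∀ i, i ≠ (0 : Fin (n + 2)) → a i ≤ 0) ∧ 0 < a 0} := by
  refine ⟨?_, ?_, ?_⟩ <;> ext (a : Fin (n + 2) → ℤ) <;> rw [mem_Sset_iff]
  · simp only [Equiv.Perm.one_apply]
    constructor
    · intro h
      refine ⟨fun i j hij => ?_, fun i => ?_⟩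
      · rcases hij.eq_or_lt with rfl | hlt
        · exact le_rfl
        · have := (h j.castSucc i.castSucc hlt).1 hlt
          rwa [expo_castSucc, expo_castSucc] at this
      · have := (h (Fin.last _) i.castSucc i.castSucc_lt_last).1 i.castSucc_lt_last
        rwa [expo_castSucc, expo_last] at this
    · rintro ⟨hmono, hneg⟩ i j hji
      refine ⟨fun _ => ?_, fun h => absurd h hji.asymm⟩
      obtain ⟨j, rfl⟩ := Fin.exists_castSucc_eq.mpr (Fin.ne_last_of_lt hji)
      induction i using Fin.lastCases with
      | last => rw [expo_castSucc, expo_last]; exact hneg j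
      | cast i => rw [expo_castSucc, expo_castSucc]; exact hmono j i hji.le
  · simp only [swap_zero_one_lt_iff]
    have h0 : expo (n + 3) a 0 = a 0 := expo_castSucc n a 0
    have h1 : expo (n + 3) a 1 = a 1 := expo_castSucc n a 1
    constructor
    · intro h
      refine ⟨?_, fun i j hij hi hj => ?_, fun i hi => ?_⟩
      · have := (h 0 1 (Or.inl ⟨rfl, rfl⟩)).2 Fin.zero_lt_one
        rw [h0, h1] at this
        omega
      · rcases hij.eq_or_lt with rfl | hlt
        · exact le_rfl
        · have := (h j.castSucc i.castSucc (Or.inr ⟨hlt, fun hh => hj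
            (Fin.castSucc_injective _ hh.2)⟩)).1 hlt
          rwa [expo_castSucc, expo_castSucc] at this
      · have := (h (Fin.last _) i.castSucc (Or.inr ⟨i.castSucc_lt_last, fun hh => by
          have : n + 2 = 1 := congrArg Fin.val hh.2
          omega⟩)).1 i.castSucc_lt_last
        rwa [expo_castSucc, expo_last] at this
    · rintro ⟨h10, hmono, hneg⟩ i j (⟨rfl, rfl⟩ | ⟨hji, hne⟩)
      · rw [h0, h1]
        exact ⟨fun h => absurd h (by simp), fun _ => by omega⟩
      · refine ⟨fun _ => ?_, fun h => absurd h hji.asymm⟩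
        obtain ⟨j, rfl⟩ := Fin.exists_castSucc_eq.mpr (Fin.ne_last_of_lt hji)
        have ha0 := hneg 0 Fin.zero_ne_one
        induction i using Fin.lastCases with
        | last =>
          rw [expo_castSucc, expo_last]
          rcases eq_or_ne j 1 with rfl | hj
          · omega
          · exact hneg j hj
        | cast i =>
          rw [expo_castSucc, expo_castSucc]
          have hi : i ≠ 1 := by
            rintro rfl
            refine hne ⟨?_, rfl⟩
            exact Fin.ext (Nat.lt_one_iff.mp hji)
          rcases eq_or_ne j 1 with rfl | hj
          · have := hmono 0 i (Fin.zero_le _) Fin.zero_ne_one hi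
            omega
          · exact hmono j i hji.le hj hi
  · have h0 : expo (n + 3) a 0 = a 0 := expo_castSucc n a 0
    constructor
    · intro h
      have key : ∀ i j : Fin (n + 3), j ≠ 0 → j < i → expo (n + 3) a j ≤ expo (n + 3) a i := by
        intro i j hj hji
        refine (h i j ?_).1 hji
        obtain ⟨j, rfl⟩ := Fin.exists_succ_eq.mpr hj
        obtain ⟨i, rfl⟩ := Fin.exists_succ_eq.mpr (Fin.ne_zero_of_lt hji)
        rw [w2_succ, w2_succ]
        exact Fin.succ_lt_succ_iff.mp hji
      have hne : ∀ i : Fin (n + 2), i ≠ 0 → i.castSucc ≠ 0 := fun i hi =>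
        Fin.castSucc_ne_zero_iff.mpr hi
      refine ⟨fun i j hij hi => ?_, fun i hi => ?_, ?_⟩
      · rcases hij.eq_or_lt with rfl | hlt
        · exact le_rfl
        · have := key j.castSucc i.castSucc (hne i hi) hlt
          rwa [expo_castSucc, expo_castSucc] at this
      · have := key (Fin.last _) i.castSucc (hne i hi) i.castSucc_lt_last
        rwa [expo_castSucc, expo_last] at this
      · have := (h 0 (Fin.last _) (by
          rw [w2_zero, ← Fin.succ_last, w2_succ]
          exact Fin.castSucc_lt_last _)).2 (Fin.last_pos)
        rwa [h0, expo_last] at this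
    · rintro ⟨hmono, hneg, hpos⟩ i j hσ
      have hj : j ≠ 0 := by
        rintro rfl
        rw [w2_zero] at hσ
        exact absurd hσ (Fin.le_last _).not_gt
      rcases eq_or_ne i 0 with rfl | hi
      · refine ⟨fun h => absurd h (Fin.not_lt_zero _), fun _ => ?_⟩
        rw [h0]
        induction j using Fin.lastCases with
        | last => rwa [expo_last]
        | cast j =>
          rw [expo_castSucc]
          exact (hneg j (Fin.castSucc_ne_zero_iff.mp hj)).trans_lt hpos
      · have hji : j < i := by
          obtain ⟨j, rfl⟩ := Fin.exists_succ_eq.mpr hj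
          obtain ⟨i, rfl⟩ := Fin.exists_succ_eq.mpr hi
          rw [w2_succ, w2_succ] at hσ
          exact Fin.succ_lt_succ_iff.mpr hσ
        refine ⟨fun _ => ?_, fun h => absurd h hji.asymm⟩
        obtain ⟨j, rfl⟩ := Fin.exists_castSucc_eq.mpr (Fin.ne_last_of_lt hji)
        have hj' := Fin.castSucc_ne_zero_iff.mp hj
        induction i using Fin.lastCases with
        | last => rw [expo_castSucc, expo_last]; exact hneg j hj'
        | cast i => rw [expo_castSucc, expo_castSucc]; exact hmono j i hji.le hj'

end IH
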